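/- Let A ∈ ℂ^{m×n}, W ∈ ℂ^{n×m} with rank(WAW) = rank(A), and let k = ind(A,W). Then the following are equivalent: (i) k ≤ 1; (ii) A has a unique {1',2',3',1^{k}'}-inverse, i.e., there is exactly one X ∈ ℂ^{m×n} satisfying AWXWA = A, XWAWX = X, (WAWX)* = WAWX, and XW(AW)^{k+1} = (AW)^k. -/

import Mathlib

open Matrix

/-- The index of a square complex matrix: the smallest nonnegative integer `k` with
`rank (M ^ k) = rank (M ^ (k + 1))`. -/
noncomputable def matIndex {p : ℕ} (M : Matrix (Fin p) (Fin p) ℂ) : ℕ :=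
  sInf {k : ℕ | (M ^ k).rank = (M ^ (k + 1)).rank}

/-- The weighted index `ind(A, W) = max (ind (A * W)) (ind (W * A))`. -/
noncomputable def wIndex {m n : ℕ} (A : Matrix (Fin m) (Fin n) ℂ)
    (W : Matrix (Fin n) (Fin m) ℂ) : ℕ :=
  max (matIndex (A * W)) (matIndex (W * A))

theorem rank_pow_stabilizes {p : ℕ} (M : Matrix (Fin p) (Fin p) ℂ) :
    ∃ k : ℕ, (M ^ k).rank = (M ^ (k + 1)).rank := by
  by_contra! h
  have hanti : StrictAnti fun k : ℕ => (M ^ k).rank :=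
    strictAnti_nat_of_succ_lt fun k =>
      lt_of_le_of_ne (by rw [pow_succ]; exact rank_mul_le_left _ _) (h k).symm
  exact WellFounded.not_rel_apply_succ (r := (· < ·)) (fun k : ℕ => (M ^ k).rank) |>.elim
    fun k hk => hk (hanti k.lt_succ_self)

theorem rank_pow_matIndex {p : ℕ} (M : Matrix (Fin p) (Fin p) ℂ) :
    (M ^ matIndex M).rank = (M ^ (matIndex M + 1)).rank :=
  Nat.sInf_mem (s := {k : ℕ | (M ^ k).rank = (M ^ (k + 1)).rank}) (rank_pow_stabilizes M)

/-- If right multiplication by `C` preserves the rank of `B`, it can be undone on `B`. -/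
theorem exists_mul_eq_of_rank_mul_eq_left {l m n : ℕ} (B : Matrix (Fin l) (Fin m) ℂ)
    (C : Matrix (Fin m) (Fin n) ℂ) (h : (B * C).rank = B.rank) :
    ∃ D : Matrix (Fin n) (Fin m) ℂ, B * C * D = B := by
  have hle : LinearMap.range (B * C).mulVecLin ≤ LinearMap.range B.mulVecLin := by
    rw [mulVecLin_mul]
    exact LinearMap.range_comp_le_range _ _
  have heq := Submodule.eq_of_le_of_finrank_eq hle h
  have hcol : ∀ j, ∃ v, (B * C) *ᵥ v = B.col j := by
    intro j
    have : B.col j ∈ LinearMap.range (B * C).mulVecLin := by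
      rw [heq]
      exact ⟨Pi.single j 1, by simp⟩
    exact this
  choose f hf using hcol
  refine ⟨Matrix.of fun i j => f j i, ?_⟩
  ext i j
  exact congrFun (hf j) i

/-- If left multiplication by `B` preserves the rank of `C`, it can be undone on `C`. -/
theorem exists_mul_eq_of_rank_mul_eq_right {l m n : ℕ} (B : Matrix (Fin l) (Fin m) ℂ)
    (C : Matrix (Fin m) (Fin n) ℂ) (h : (B * C).rank = C.rank) :
    ∃ D : Matrix (Fin m) (Fin l) ℂ, D * (B * C) = C := by
  obtain ⟨D, hD⟩ := exists_mul_eq_of_rank_mul_eq_left Cᵀ Bᵀ (by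
    rw [← transpose_mul, rank_transpose, rank_transpose, h])
  refine ⟨Dᵀ, ?_⟩
  simpa [transpose_mul] using congrArg transpose hD

open scoped ComplexOrder in
/-- Every matrix has a least-squares generalized inverse. -/
theorem exists_leastSquares_inverse {m n : ℕ} (B : Matrix (Fin m) (Fin n) ℂ) :
    ∃ G : Matrix (Fin n) (Fin m) ℂ, B * G * B = B ∧ (B * G)ᴴ = B * G := by
  obtain ⟨G, hG⟩ := exists_mul_eq_of_rank_mul_eq_left Bᴴ B (by
    rw [rank_conjTranspose_mul_self, rank_conjTranspose])
  have hsq : (B * G)ᴴ * (B * G) = (B * G)ᴴ := by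
    rw [conjTranspose_mul, Matrix.mul_assoc, ← Matrix.mul_assoc Bᴴ, hG]
  have hherm : (B * G)ᴴ = B * G := by
    have := congrArg conjTranspose hsq
    rw [conjTranspose_mul, conjTranspose_conjTranspose, hsq] at this
    exact this
  refine ⟨G, ?_, hherm⟩
  have := congrArg conjTranspose hG
  rw [conjTranspose_mul, conjTranspose_mul, conjTranspose_conjTranspose, ← Matrix.mul_assoc,
    ← conjTranspose_mul, hherm] at this
  exact this

theorem exists_mul_eq_one_of_matIndex_eq_zero {p : ℕ} (M : Matrix (Fin p) (Fin p) ℂ)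
    (h : matIndex M = 0) : ∃ D, M * D = 1 := by
  have hr := rank_pow_matIndex M
  rw [h, zero_add, pow_zero, pow_one] at hr
  obtain ⟨D, hD⟩ := exists_mul_eq_of_rank_mul_eq_left 1 M (by rw [Matrix.one_mul, hr])
  exact ⟨D, by rwa [Matrix.one_mul] at hD⟩

theorem matIndex_le_one_iff {p : ℕ} (M : Matrix (Fin p) (Fin p) ℂ) :
    matIndex M ≤ 1 ↔ (M * M).rank = M.rank := by
  constructor
  · intro h
    rcases Nat.le_one_iff_eq_zero_or_eq_one.mp h with h | h
    · obtain ⟨D, hD⟩ := exists_mul_eq_one_of_matIndex_eq_zero M h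
      refine le_antisymm (rank_mul_le_left _ _) ?_
      have := rank_mul_le_left (M * M) D
      rwa [Matrix.mul_assoc, hD, Matrix.mul_one] at this
    · have hr := rank_pow_matIndex M
      rw [h, pow_one, pow_succ, pow_one] at hr
      exact hr.symm
  · intro h
    refine Nat.sInf_le ?_
    change (M ^ 1).rank = (M ^ (1 + 1)).rank
    rw [pow_one, pow_succ, pow_one, h]

/-- A rank drop under right multiplication is witnessed by a row vector. -/
theorem exists_vecMul_mul_eq_zero_of_rank_ne {l m n : ℕ} (B : Matrix (Fin l) (Fin m) ℂ)
    (C : Matrix (Fin m) (Fin n) ℂ) (h : (B * C).rank ≠ B.rank) :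
    ∃ v : Fin l → ℂ, v ᵥ* (B * C) = 0 ∧ v ᵥ* B ≠ 0 := by
  by_contra! hv
  have hker : LinearMap.ker (B * C)ᵀ.mulVecLin = LinearMap.ker Bᵀ.mulVecLin := by
    ext v
    simp only [LinearMap.mem_ker, mulVecLin_apply, mulVec_transpose]
    exact ⟨hv v, fun hB => by rw [← vecMul_vecMul, hB, zero_vecMul]⟩
  have h1 := LinearMap.finrank_range_add_finrank_ker (B * C)ᵀ.mulVecLin
  have h2 := LinearMap.finrank_range_add_finrank_ker Bᵀ.mulVecLin
  rw [hker] at h1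
  apply h
  rw [← rank_transpose (B * C), ← rank_transpose B]
  exact Nat.add_right_cancel (h1.trans h2.symm)

section WeightedRank

variable {m n : ℕ} {A : Matrix (Fin m) (Fin n) ℂ} {W : Matrix (Fin n) (Fin m) ℂ}

theorem rank_mul_eq_of_rank_mul_mul_eq (h : (W * A * W).rank = A.rank) :
    (W * A).rank = A.rank ∧ (A * W).rank = A.rank := by
  refine ⟨le_antisymm (rank_mul_le_right _ _) ?_, le_antisymm (rank_mul_le_left _ _) ?_⟩
  · rw [← h]
    exact rank_mul_le_left _ _
  · rw [← h, Matrix.mul_assoc]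
    exact rank_mul_le_right _ _

theorem rank_mul_self_comm (h : (W * A * W).rank = A.rank) :
    (W * A * (W * A)).rank = (A * W * (A * W)).rank := by
  obtain ⟨hWA, hAW⟩ := rank_mul_eq_of_rank_mul_mul_eq h
  obtain ⟨D, hD⟩ := exists_mul_eq_of_rank_mul_eq_left A W hAW
  obtain ⟨C, hC⟩ := exists_mul_eq_of_rank_mul_eq_right W A hWA
  refine le_antisymm ?_ ?_
  · calc (W * A * (W * A)).rank = (W * (A * W * (A * W)) * D).rank := by
          nth_rw 2 [← hD]
          simp only [Matrix.mul_assoc]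
      _ ≤ (W * (A * W * (A * W))).rank := rank_mul_le_left _ _
      _ ≤ _ := rank_mul_le_right _ _
  · calc (A * W * (A * W)).rank = (C * (W * A * (W * A)) * W).rank := by
          nth_rw 1 [← hC]
          simp only [Matrix.mul_assoc]
      _ ≤ (C * (W * A * (W * A))).rank := rank_mul_le_left _ _
      _ ≤ _ := rank_mul_le_right _ _

theorem wIndex_le_one_iff (h : (W * A * W).rank = A.rank) :
    wIndex A W ≤ 1 ↔ (A * W * (A * W)).rank = A.rank := by
  obtain ⟨hWA, hAW⟩ := rank_mul_eq_of_rank_mul_mul_eq h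
  rw [wIndex, max_le_iff, matIndex_le_one_iff, matIndex_le_one_iff, rank_mul_self_comm h, hWA,
    hAW, and_self]

theorem mul_pow_wIndex_eq_iff (h : wIndex A W ≤ 1) (X : Matrix (Fin m) (Fin n) ℂ) :
    X * W * (A * W) ^ (wIndex A W + 1) = (A * W) ^ wIndex A W ↔
      X * W * (A * W * (A * W)) = A * W := by
  rcases Nat.le_one_iff_eq_zero_or_eq_one.mp h with h0 | h1
  · have hAW : matIndex (A * W) = 0 := by
      have := le_max_left (matIndex (A * W)) (matIndex (W * A))
      rw [wIndex] at h0
      omega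
    obtain ⟨D, hD⟩ := exists_mul_eq_one_of_matIndex_eq_zero _ hAW
    rw [h0, zero_add, pow_one, pow_zero]
    constructor
    · intro hX
      rw [← Matrix.mul_assoc (X * W), hX, Matrix.one_mul]
    · intro hX
      have := congrArg (· * D) hX
      simp only [Matrix.mul_assoc (X * W), Matrix.mul_assoc (A * W) (A * W), hD,
        Matrix.mul_one] at this
      exact this
  · rw [h1, pow_succ, pow_one]

/-- Existence of the inverse in the case of weighted index at most one. -/
theorem exists_inverse_of_rank_mul_self_eq (h : (W * A * W).rank = A.rank)
    (h2 : (A * W * (A * W)).rank = A.rank) :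
    ∃ X : Matrix (Fin m) (Fin n) ℂ,
      A * W * X * W * A = A ∧ X * W * A * W * X = X ∧
        (W * A * W * X)ᴴ = W * A * W * X ∧ X * W * (A * W * (A * W)) = A * W := by
  obtain ⟨hWA, hAW⟩ := rank_mul_eq_of_rank_mul_mul_eq h
  have hsq : (W * A * (W * A)).rank = A.rank := (rank_mul_self_comm h).trans h2
  obtain ⟨G, hG, hGH⟩ := exists_leastSquares_inverse (W * A * (W * A))
  obtain ⟨C, hC⟩ := exists_mul_eq_of_rank_mul_eq_right (W * A * W) A (by
    rw [← hsq]; simp only [Matrix.mul_assoc])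
  obtain ⟨D, hD⟩ := exists_mul_eq_of_rank_mul_eq_left (W * A) (W * A) (hsq.trans hWA.symm)
  obtain ⟨E, hE⟩ := exists_mul_eq_of_rank_mul_eq_right W A hWA
  have hAGB : A * (G * (W * (A * (W * A)))) = A := by
    calc A * (G * (W * (A * (W * A))))
        = C * (W * A * (W * A) * G * (W * A * (W * A))) := by
          nth_rw 1 [← hC]
          simp only [Matrix.mul_assoc]
      _ = A := by
          rw [hG]
          simpa only [Matrix.mul_assoc] using hC
  have hAD : A * (W * (A * D)) = A := by
    calc A * (W * (A * D)) = E * (W * A * (W * A) * D) := by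
          nth_rw 1 [← hE]
          simp only [Matrix.mul_assoc]
      _ = A := by rw [hD, hE]
  refine ⟨A * G, ?_, ?_, ?_, ?_⟩
  · calc A * W * (A * G) * W * A = A * W * (A * (G * (W * A))) := by
          simp only [Matrix.mul_assoc]
      _ = A * W * (A * (G * (W * (A * (W * A))))) * D := by
          nth_rw 1 [← hD]
          simp only [Matrix.mul_assoc]
      _ = A := by
          rw [hAGB]
          simpa only [Matrix.mul_assoc] using hAD
  · calc A * G * W * A * W * (A * G) = A * (G * (W * (A * (W * A)))) * G := by
          simp only [Matrix.mul_assoc]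
      _ = A * G := by rw [hAGB]
  · simpa only [Matrix.mul_assoc] using hGH
  · calc A * G * W * (A * W * (A * W)) = A * (G * (W * (A * (W * A)))) * W := by
          simp only [Matrix.mul_assoc]
      _ = A * W := by rw [hAGB]

/-- A solution `X` has range contained in that of `A`. -/
theorem exists_eq_mul_of_inverse (h : (W * A * W).rank = A.rank) {X : Matrix (Fin m) (Fin n) ℂ}
    (hX2 : X * W * A * W * X = X) (hX4 : X * W * (A * W * (A * W)) = A * W) :
    X * W * A * W * A = A ∧ ∃ Z : Matrix (Fin n) (Fin n) ℂ, X = A * Z := by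
  obtain ⟨-, hAW⟩ := rank_mul_eq_of_rank_mul_mul_eq h
  obtain ⟨D, hD⟩ := exists_mul_eq_of_rank_mul_eq_left A W hAW
  have hXA : X * W * A * W * A = A := by
    calc X * W * A * W * A = X * W * (A * W * (A * W)) * D := by
          nth_rw 2 [← hD]
          simp only [Matrix.mul_assoc]
      _ = A := by rw [hX4, hD]
  refine ⟨hXA, ?_⟩
  have hrX : X.rank ≤ A.rank := by
    calc X.rank = (X * (W * A * W) * X).rank := by
          conv_lhs => rw [← hX2]
          simp only [Matrix.mul_assoc]
      _ ≤ (X * (W * A * W)).rank := rank_mul_le_left _ _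
      _ ≤ (W * A * W).rank := rank_mul_le_right _ _
      _ = A.rank := h
  have hXA' : X * (W * A * W * A) = A := by simpa only [Matrix.mul_assoc] using hXA
  obtain ⟨Z, hZ⟩ := exists_mul_eq_of_rank_mul_eq_left X (W * A * W * A)
    (le_antisymm (rank_mul_le_left _ _) (by rwa [hXA']))
  exact ⟨Z, by rw [← hZ, hXA']⟩

/-- Uniqueness of the inverse in the case of weighted index at most one. -/
theorem inverse_unique (h : (W * A * W).rank = A.rank) {X Y : Matrix (Fin m) (Fin n) ℂ}
    (hX1 : A * W * X * W * A = A) (hX2 : X * W * A * W * X = X)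
    (hX3 : (W * A * W * X)ᴴ = W * A * W * X) (hX4 : X * W * (A * W * (A * W)) = A * W)
    (hY1 : A * W * Y * W * A = A) (hY2 : Y * W * A * W * Y = Y)
    (hY3 : (W * A * W * Y)ᴴ = W * A * W * Y) (hY4 : Y * W * (A * W * (A * W)) = A * W) :
    X = Y := by
  obtain ⟨-, Z, hZ⟩ := exists_eq_mul_of_inverse h hX2 hX4
  obtain ⟨hYA, -⟩ := exists_eq_mul_of_inverse h hY2 hY4
  have hYX : W * A * W * Y * (W * A * W * X) = W * A * W * X := by
    calc W * A * W * Y * (W * A * W * X) = W * (A * W * Y * W * A) * W * X := by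
          simp only [Matrix.mul_assoc]
      _ = W * A * W * X := by rw [hY1]
  have hXY : W * A * W * X * (W * A * W * Y) = W * A * W * Y := by
    calc W * A * W * X * (W * A * W * Y) = W * (A * W * X * W * A) * W * Y := by
          simp only [Matrix.mul_assoc]
      _ = W * A * W * Y := by rw [hX1]
  have hMXY : W * A * W * X = W * A * W * Y := by
    have := congrArg conjTranspose hYX
    rw [conjTranspose_mul, hX3, hY3, hXY] at this
    exact this.symm
  calc X = Y * W * A * W * A * Z := by rw [hYA, ← hZ]
    _ = Y * (W * A * W * X) := by
        rw [hZ]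
        simp only [Matrix.mul_assoc]
    _ = Y := by
        rw [hMXY]
        simpa only [Matrix.mul_assoc] using hY2

/-- When `A * W` has index at least two, an inverse can be perturbed. -/
theorem exists_ne_inverse (h : (W * A * W).rank = A.rank)
    (h2 : (A * W * (A * W)).rank ≠ A.rank) {k : ℕ} (hk : 1 ≤ k) {X : Matrix (Fin m) (Fin n) ℂ}
    (hX1 : A * W * X * W * A = A) (hX2 : X * W * A * W * X = X)
    (hX3 : (W * A * W * X)ᴴ = W * A * W * X)
    (hX4 : X * W * (A * W) ^ (k + 1) = (A * W) ^ k) :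
    ∃ Y : Matrix (Fin m) (Fin n) ℂ, Y ≠ X ∧
      A * W * Y * W * A = A ∧ Y * W * A * W * Y = Y ∧
        (W * A * W * Y)ᴴ = W * A * W * Y ∧ Y * W * (A * W) ^ (k + 1) = (A * W) ^ k := by
  obtain ⟨hWA, hAW⟩ := rank_mul_eq_of_rank_mul_mul_eq h
  obtain ⟨v, hv0, hv⟩ := exists_vecMul_mul_eq_zero_of_rank_ne (W * A * W) (A * W) (by
    intro heq
    refine h2 (le_antisymm ((rank_mul_le_left _ _).trans hAW.le) ?_)
    rw [← h, ← heq, Matrix.mul_assoc W A W, Matrix.mul_assoc W]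
    exact rank_mul_le_right _ _)
  obtain ⟨u, hu, hu0⟩ : ∃ u : Fin m → ℂ, u ≠ 0 ∧ (A * W) *ᵥ u = 0 := by
    refine exists_mulVec_eq_zero_iff.mpr ?_
    by_contra hdet
    refine h2 ?_
    rw [rank_mul_eq_left_of_isUnit_det _ _ (isUnit_iff_ne_zero.mpr hdet), hAW]
  have hAWu : A * W * vecMulVec u v = 0 := by
    rw [mul_vecMulVec, hu0, zero_vecMulVec]
  have hMAW : vecMulVec u v * (W * A * W * (A * W)) = 0 := by
    rw [vecMulVec_mul, hv0, vecMulVec_zero]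
  have hM : vecMulVec u v * (W * A * W) ≠ 0 := by
    rw [vecMulVec_mul]
    exact vecMulVec_ne_zero hu hv
  generalize vecMulVec u v = Z at hAWu hMAW hM
  have hMXM : W * A * W * X * (W * A * W) = W * A * W := by
    calc W * A * W * X * (W * A * W) = W * (A * W * X * W * A) * W := by
          simp only [Matrix.mul_assoc]
      _ = W * A * W := by rw [hX1]
  obtain ⟨N, hN⟩ : ∃ N, N = Z * (W * A * W * X) := ⟨_, rfl⟩
  have hAWN : A * W * N = 0 := by
    rw [hN, ← Matrix.mul_assoc, hAWu, Matrix.zero_mul]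
  have hAWY : A * W * (X + N) = A * W * X := by rw [Matrix.mul_add, hAWN, add_zero]
  have hMY : W * A * W * (X + N) = W * A * W * X := by
    rw [Matrix.mul_assoc W, Matrix.mul_assoc W, hAWY, ← Matrix.mul_assoc W]
  refine ⟨X + N, ?_, ?_, ?_, ?_, ?_⟩
  · intro hXN
    have hN0 : N = 0 := by simpa using hXN
    refine hM ?_
    rw [← hMXM, ← Matrix.mul_assoc, ← hN, hN0, Matrix.zero_mul]
  · rw [hAWY, hX1]
  · have hYX : (X + N) * (W * A * W * X) = X + N := by
      rw [Matrix.add_mul]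
      congr 1
      · simpa only [Matrix.mul_assoc] using hX2
      · rw [hN, Matrix.mul_assoc Z, ← Matrix.mul_assoc (W * A * W * X), hMXM]
    calc (X + N) * W * A * W * (X + N) = (X + N) * (W * A * W * (X + N)) := by
          simp only [Matrix.mul_assoc]
      _ = X + N := by rw [hMY, hYX]
  · rw [hMY, hX3]
  · have hNk : N * W * (A * W) ^ (k + 1) = 0 := by
      obtain ⟨j, rfl⟩ := Nat.exists_eq_add_of_le' hk
      calc N * W * (A * W) ^ (j + 1 + 1)
          = Z * (W * A * W) * (X * W * (A * W) ^ (j + 1 + 1)) := by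
            rw [hN]
            simp only [Matrix.mul_assoc]
        _ = Z * (W * A * W * (A * W)) * (A * W) ^ j := by
            rw [hX4, pow_succ']
            simp only [Matrix.mul_assoc]
        _ = 0 := by rw [hMAW, Matrix.zero_mul]
    rw [Matrix.add_mul, Matrix.add_mul, hX4, hNk, add_zero]

end WeightedRank

/-- with `k = ind(A, W)` and `rank (W*A*W) = rank A`, one has `k ≤ 1` iff
`A` has a unique `{1',2',3',1^k'}`-inverse. -/
theorem stmt11 (m n : ℕ) (A : Matrix (Fin m) (Fin n) ℂ) (W : Matrix (Fin n) (Fin m) ℂ)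
    (k : ℕ) (hk : k = wIndex A W) (hrank : (W * A * W).rank = A.rank) :
    k ≤ 1 ↔
      ∃! X : Matrix (Fin m) (Fin n) ℂ,
        A * W * X * W * A = A ∧
        X * W * A * W * X = X ∧
        (W * A * W * X)ᴴ = W * A * W * X ∧
        X * W * (A * W) ^ (k + 1) = (A * W) ^ k := by
  subst hk
  constructor
  · intro hk
    have h2 := (wIndex_le_one_iff hrank).mp hk
    simp only [mul_pow_wIndex_eq_iff hk]
    obtain ⟨X, hX1, hX2, hX3, hX4⟩ := exists_inverse_of_rank_mul_self_eq hrank h2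
    refine ⟨X, ⟨hX1, hX2, hX3, hX4⟩, ?_⟩
    rintro Y ⟨hY1, hY2, hY3, hY4⟩
    exact inverse_unique hrank hY1 hY2 hY3 hY4 hX1 hX2 hX3 hX4
  · rintro ⟨X, ⟨hX1, hX2, hX3, hX4⟩, huniq⟩
    by_contra hk
    have h2 := mt (wIndex_le_one_iff hrank).mpr hk
    obtain ⟨Y, hne, hY⟩ := exists_ne_inverse hrank h2 (by omega) hX1 hX2 hX3 hX4
    exact hne (huniq Y hY)
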